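/- The sum over k >= 0 of (H_{2k} - H_k) * k / ((3k+1) * binomial(3k,k) * 2^{k+1}) equals -π/200 + 9π²/4000 + (3/100)·ln 2 + (27/1000)·(ln 2)² - (13/1000)·π·ln 2. -/

import Mathlib

open Real

open MeasureTheory Set Filter Topology

lemma aux_int_w : IntegrableOn (fun t : ℝ => |Real.log t| / (1 + t) ^ 2) (Ioi 0) := by
  rw [← Ioc_union_Ioi_eq_Ioi (zero_le_one' ℝ)]
  have hm : Measurable (fun t : ℝ => |Real.log t| / (1 + t) ^ 2) := by
    refine Measurable.div ?_ ?_
    · exact measurable_log.abs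
    · fun_prop
  refine IntegrableOn.union ?_ ?_
  · have h1 : IntegrableOn Real.log (Ioc 0 1) := by
      have := (intervalIntegral.intervalIntegrable_log' (a := 0) (b := 1))
      rwa [intervalIntegrable_iff_integrableOn_Ioc_of_le zero_le_one] at this
    refine Integrable.mono h1 hm.aestronglyMeasurable ?_
    refine (ae_restrict_iff' measurableSet_Ioc).2 (Eventually.of_forall fun t ht => ?_)
    rw [Real.norm_eq_abs, Real.norm_eq_abs, abs_div, abs_abs]
    refine div_le_self (abs_nonneg _) ?_
    rw [abs_of_nonneg (by positivity)]
    nlinarith [ht.1]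
  · have h1 : IntegrableOn (fun t : ℝ => 2 * t ^ (-(3/2) : ℝ)) (Ioi 1) :=
      (integrableOn_Ioi_rpow_of_lt (by norm_num) one_pos).const_mul 2
    refine Integrable.mono h1 hm.aestronglyMeasurable ?_
    refine (ae_restrict_iff' measurableSet_Ioi).2 (Eventually.of_forall fun t ht => ?_)
    have ht1 : (1:ℝ) < t := ht
    have ht0 : (0:ℝ) < t := by linarith
    rw [Real.norm_eq_abs, Real.norm_eq_abs, abs_of_nonneg (by positivity : 0 ≤ |Real.log t| / (1 + t) ^ 2),
      abs_of_nonneg (Real.log_nonneg ht1.le), abs_of_nonneg (by positivity)]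
    have h2 := Real.log_le_rpow_div ht0.le (show (0:ℝ) < 1/2 by norm_num)
    have h3 : (t:ℝ) ^ (-(3/2) : ℝ) = t ^ (1/2 : ℝ) / t ^ 2 := by
      rw [← Real.rpow_natCast t 2, ← Real.rpow_sub ht0]; norm_num
    rw [h3]
    have h4 : t ^ 2 ≤ (1 + t) ^ 2 := by nlinarith
    calc Real.log t / (1 + t) ^ 2 ≤ Real.log t / t ^ 2 :=
          div_le_div_of_nonneg_left (Real.log_nonneg ht1.le) (by positivity) h4
      _ ≤ (t ^ (1/2 : ℝ) / (1/2)) / t ^ 2 := by gcongr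
      _ = _ := by ring

lemma aux_int_one : IntegrableOn (fun t : ℝ => 1 / (1 + t) ^ 2) (Ioi 0) := by
  refine integrableOn_Ioi_deriv_of_nonneg' (g := fun t : ℝ => - (1 / (1 + t))) (l := 0) ?_ ?_ ?_
  · intro x hx
    have hx0 : (1 + x) ≠ 0 := by have : (0:ℝ) ≤ x := hx; positivity
    have := (((hasDerivAt_id' x).const_add 1).fun_inv hx0).fun_neg
    simpa [neg_div] using this
  · intro x hx; positivity
  · have : Tendsto (fun t : ℝ => 1 + t) atTop atTop := tendsto_atTop_add_const_left _ _ tendsto_id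
    simpa using this.inv_tendsto_atTop.neg

lemma aux_log_div : Tendsto (fun t : ℝ => Real.log t / t) atTop (𝓝 0) :=
  Real.isLittleO_log_id_atTop.tendsto_div_nhds_zero

/-- the beta weight -/
noncomputable def wt (m n : ℕ) (t : ℝ) : ℝ := (t / (1 + t)) ^ m * (1 / (1 + t)) ^ n

lemma wt_nonneg (m n : ℕ) {t : ℝ} (ht : 0 < t) : 0 ≤ wt m n t := by
  unfold wt; positivity

lemma wt_le (m n : ℕ) {t : ℝ} (ht : 0 < t) : wt m n t ≤ 1 := by
  unfold wt
  refine mul_le_one₀ (pow_le_one₀ (by positivity) ?_) (by positivity) (pow_le_one₀ (by positivity) ?_)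
  · rw [div_le_one (by positivity)]; linarith
  · rw [div_le_one (by positivity)]; linarith

lemma wt_meas (m n : ℕ) : Measurable (wt m n) := by
  unfold wt; fun_prop

lemma wt_split (m n : ℕ) {t : ℝ} (ht : 0 < t) : wt m n t = wt (m+1) n t + wt m (n+1) t := by
  unfold wt
  have : (1 + t) ≠ 0 := by positivity
  rw [pow_succ, pow_succ]
  field_simp
  ring

lemma wt_deriv (m n : ℕ) {t : ℝ} (ht : 0 < t) : HasDerivAt (wt (m+1) (n+1))
    (((m+1) * wt m (n+1) t - (n+1) * wt (m+1) n t) / (1+t)^2) t := by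
  have h0 : (1 + t) ≠ 0 := by positivity
  have h1 : HasDerivAt (fun t : ℝ => 1 + t) 1 t := (hasDerivAt_id t).const_add 1
  have h2 := (((hasDerivAt_id' t).fun_div h1 h0).fun_pow (m+1)).fun_mul ((((hasDerivAt_const t (1:ℝ)).fun_div h1 h0)).fun_pow (n+1))
  unfold wt
  refine h2.congr_deriv ?_
  push_cast
  field_simp
  ring

lemma wt_int (m n : ℕ) : IntegrableOn (fun t => wt m n t / (1+t)^2) (Ioi 0) := by
  refine Integrable.mono aux_int_one ((wt_meas m n).div (by fun_prop)).aestronglyMeasurable ?_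
  refine (ae_restrict_iff' measurableSet_Ioi).2 (Eventually.of_forall fun t ht => ?_)
  have h := wt_nonneg m n ht
  rw [Real.norm_eq_abs, Real.norm_eq_abs, abs_of_nonneg (by positivity), abs_of_nonneg (by positivity)]
  have := wt_le m n ht
  gcongr

lemma wtl_le (m n : ℕ) {t : ℝ} (ht : 0 < t) :
    ‖wt m n t * Real.log t / (1+t)^2‖ ≤ |Real.log t| / (1+t)^2 := by
  have h := wt_nonneg m n ht
  rw [Real.norm_eq_abs, abs_div, abs_mul, abs_of_nonneg h, abs_of_nonneg (by positivity : (0:ℝ) ≤ (1+t)^2)]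
  have := wt_le m n ht
  gcongr
  nlinarith [abs_nonneg (Real.log t)]

lemma wtl_meas (m n : ℕ) : Measurable (fun t => wt m n t * Real.log t / (1+t)^2) :=
  ((wt_meas m n).mul measurable_log).div (by fun_prop)

lemma wtl_int (m n : ℕ) : IntegrableOn (fun t => wt m n t * Real.log t / (1+t)^2) (Ioi 0) := by
  refine Integrable.mono aux_int_w (wtl_meas m n).aestronglyMeasurable ?_
  refine (ae_restrict_iff' measurableSet_Ioi).2 (Eventually.of_forall fun t ht => ?_)
  refine (wtl_le m n ht).trans (le_abs_self _)

noncomputable def BB (m n : ℕ) : ℝ := ∫ t in Ioi (0:ℝ), wt m n t / (1+t)^2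
noncomputable def LL (m n : ℕ) : ℝ := ∫ t in Ioi (0:ℝ), wt m n t * Real.log t / (1+t)^2

lemma BB_split (m n : ℕ) : BB m n = BB (m+1) n + BB m (n+1) := by
  unfold BB
  rw [← integral_add (wt_int _ _) (wt_int _ _)]
  refine setIntegral_congr_fun measurableSet_Ioi fun t ht => ?_
  rw [wt_split m n ht]; ring

lemma LL_split (m n : ℕ) : LL m n = LL (m+1) n + LL m (n+1) := by
  unfold LL
  rw [← integral_add (wtl_int _ _) (wtl_int _ _)]
  refine setIntegral_congr_fun measurableSet_Ioi fun t ht => ?_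
  rw [wt_split m n ht]; ring

lemma wt_cont0 (m n : ℕ) : ContinuousAt (wt m n) 0 := by
  unfold wt
  have h : ContinuousAt (fun t : ℝ => 1 + t) 0 := by fun_prop
  exact ((continuousAt_id.div h (by norm_num)).pow m).mul ((continuousAt_const.div h (by norm_num)).pow n)

lemma wt_le_inv (m n : ℕ) {t : ℝ} (ht : 0 < t) : wt m (n+1) t ≤ 1 / t := by
  have h : wt m (n+1) t = wt m n t * (1 / (1+t)) := by unfold wt; ring
  rw [h]
  calc wt m n t * (1 / (1+t)) ≤ 1 * (1 / t) := by
        gcongr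
        · exact wt_le m n ht
        · linarith
    _ = _ := one_mul _

lemma BB_rec (m n : ℕ) : (m+1) * BB m (n+1) - (n+1) * BB (m+1) n = 0 := by
  have hi : IntegrableOn (fun t => ((m+1) * wt m (n+1) t - (n+1) * wt (m+1) n t) / (1+t)^2) (Ioi (0:ℝ)) := by
    have := ((wt_int m (n+1)).const_mul ((m:ℝ)+1)).sub ((wt_int (m+1) n).const_mul ((n:ℝ)+1))
    refine this.congr (Eventually.of_forall fun t => ?_)
    simp only [Pi.sub_apply]; ring
  have h := integral_Ioi_of_hasDerivAt_of_tendsto (f := wt (m+1) (n+1)) (m := 0) (a := 0)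
    (wt_cont0 _ _).continuousWithinAt (fun t ht => wt_deriv m n ht) hi ?_
  · have h0 : wt (m+1) (n+1) 0 = 0 := by simp [wt]
    rw [h0, sub_zero] at h
    rw [← h, BB, BB, ← integral_const_mul, ← integral_const_mul,
      ← integral_sub ((wt_int m (n+1)).const_mul _) ((wt_int (m+1) n).const_mul _)]
    congr 1; ext t; ring
  · refine squeeze_zero' (eventually_gt_atTop 0 |>.mono fun t ht => wt_nonneg _ _ ht)
      (eventually_gt_atTop 0 |>.mono fun t ht => wt_le_inv (m+1) n ht) ?_
    exact (tendsto_inv_atTop_zero (𝕜 := ℝ)).congr fun t => (one_div t).symm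

lemma LL_rec (m n : ℕ) : (m+1) * LL m (n+1) - (n+1) * LL (m+1) n + BB m n = 0 := by
  have hi' := (((wtl_int m (n+1)).const_mul ((m:ℝ)+1)).sub ((wtl_int (m+1) n).const_mul ((n:ℝ)+1)))
  have hi := hi'.add (wt_int m n)
  have h := integral_Ioi_of_hasDerivAt_of_tendsto (f := fun t => wt (m+1) (n+1) t * Real.log t)
    (m := 0) (a := 0) ?_ ?_ hi ?_
  · have h0 : wt (m+1) (n+1) 0 = 0 := by simp [wt]
    rw [h0, zero_mul, sub_zero] at h
    rw [← h, LL, LL, BB, ← integral_const_mul, ← integral_const_mul,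
      ← integral_sub ((wtl_int m (n+1)).const_mul _) ((wtl_int (m+1) n).const_mul _),
      ]
    exact (integral_add hi' (wt_int m n)).symm
  · have h : (fun t => wt (m+1) (n+1) t * Real.log t) = fun t => wt m (n+2) t * (t * Real.log t) := by
      ext t
      unfold wt
      rw [pow_succ, pow_succ (1 / (1+t)) (n+1)]; ring
    rw [h]
    exact ((wt_cont0 _ _).mul Real.continuous_mul_log.continuousAt).continuousWithinAt
  · intro t ht
    have ht : 0 < t := ht
    have := (wt_deriv m n ht).fun_mul (Real.hasDerivAt_log ht.ne')
    refine this.congr_deriv ?_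
    have h : wt (m+1) (n+1) t = wt m n t * t / (1+t)^2 := by
      unfold wt
      rw [pow_succ, pow_succ]
      field_simp
    simp only [Pi.add_apply, Pi.sub_apply]
    rw [h]
    field_simp
  · refine squeeze_zero_norm' (a := fun t => Real.log t / t) ?_ aux_log_div
    filter_upwards [eventually_gt_atTop 1] with t ht
    have ht0 : 0 < t := by linarith
    rw [norm_mul, Real.norm_eq_abs, Real.norm_eq_abs, abs_of_nonneg (wt_nonneg _ _ ht0),
      abs_of_nonneg (Real.log_nonneg ht.le)]
    have := wt_le_inv (m+1) n ht0
    have h2 := Real.log_nonneg ht.le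
    calc _ ≤ 1 / t * Real.log t := by gcongr
      _ = _ := by ring

lemma BB_zero : BB 0 0 = 1 := by
  unfold BB
  have h := integral_Ioi_of_hasDerivAt_of_tendsto' (a := 0) (f := fun t : ℝ => - (1 / (1 + t))) (m := 0)
    (f' := fun t => 1 / (1+t)^2) ?_ aux_int_one ?_
  · simpa [wt] using h
  · intro x hx
    have hx0 : (1 + x) ≠ 0 := by have : (0:ℝ) ≤ x := hx; positivity
    have := (((hasDerivAt_id' x).const_add 1).fun_inv hx0).fun_neg
    simpa [neg_div] using this
  · have : Tendsto (fun t : ℝ => 1 + t) atTop atTop := tendsto_atTop_add_const_left _ _ tendsto_id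
    simpa using this.inv_tendsto_atTop.neg

lemma BB_eq (m n : ℕ) : BB m n = (m.factorial * n.factorial : ℝ) / ((m+n+1).factorial : ℝ) := by
  have hm : ∀ m n : ℕ, BB (m+1) n = (m+1) / (m+n+2) * BB m n := fun m n => by
    have h1 := BB_split m n
    have h2 := BB_rec m n
    have : (m:ℝ)+n+2 ≠ 0 := by positivity
    field_simp
    linear_combination (m+1) * (-h1) - h2
  have hn : ∀ m n : ℕ, BB m (n+1) = (n+1) / (m+n+2) * BB m n := fun m n => by
    have h1 := BB_split m n
    have h2 := BB_rec m n
    have : (m:ℝ)+n+2 ≠ 0 := by positivity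
    field_simp
    linear_combination (n+1) * (-h1) + h2
  induction m with
  | zero =>
    induction n with
    | zero => simp [BB_zero]
    | succ n ih =>
      rw [hn, ih, show 0 + (n+1) + 1 = (0 + n + 1) + 1 by ring, Nat.factorial_succ (0+n+1), Nat.factorial_succ n]
      have := Nat.factorial_ne_zero (0+n+1)
      push_cast
      field_simp
      ring
  | succ m ih =>
    rw [hm, ih, show m + 1 + n + 1 = (m + n + 1) + 1 by ring, Nat.factorial_succ (m+n+1), Nat.factorial_succ m]
    have := Nat.factorial_ne_zero (m+n+1)
    push_cast
    field_simp
    ring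

lemma LL_eq (h00 : LL 0 0 = 0) (m n : ℕ) : LL m n = BB m n * ((harmonic m : ℝ) - harmonic n) := by
  have hmB : ∀ m n : ℕ, BB (m+1) n = (m+1) / (m+n+2) * BB m n := fun m n => by
    have h1 := BB_split m n
    have h2 := BB_rec m n
    have : (m:ℝ)+n+2 ≠ 0 := by positivity
    field_simp
    linear_combination (m+1) * (-h1) - h2
  have hnB : ∀ m n : ℕ, BB m (n+1) = (n+1) / (m+n+2) * BB m n := fun m n => by
    have h1 := BB_split m n
    have h2 := BB_rec m n
    have : (m:ℝ)+n+2 ≠ 0 := by positivity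
    field_simp
    linear_combination (n+1) * (-h1) + h2
  have hm : ∀ m n : ℕ, LL (m+1) n = ((m+1) * LL m n + BB m n) / (m+n+2) := fun m n => by
    have h1 := LL_split m n
    have h2 := LL_rec m n
    have : (m:ℝ)+n+2 ≠ 0 := by positivity
    field_simp
    linear_combination (m+1) * (-h1) - h2
  have hn : ∀ m n : ℕ, LL m (n+1) = ((n+1) * LL m n - BB m n) / (m+n+2) := fun m n => by
    have h1 := LL_split m n
    have h2 := LL_rec m n
    have : (m:ℝ)+n+2 ≠ 0 := by positivity
    field_simp
    linear_combination (n+1) * (-h1) + h2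
  induction m with
  | zero =>
    induction n with
    | zero => simp [h00]
    | succ n ih =>
      rw [hn, ih, hnB, harmonic_succ]
      push_cast
      field_simp
      ring
  | succ m ih =>
    rw [hm, ih, hmB, harmonic_succ]
    push_cast
    field_simp
    ring

lemma cx_ne {b : ℂ} (hb : 1/4 < b.re) {t : ℝ} (ht : 0 ≤ t) : (t : ℂ) + b ≠ 0 := by
  intro h
  have := congrArg Complex.re h
  simp at this
  linarith

lemma cx_slit {b : ℂ} (hb : 1/4 < b.re) {t : ℝ} (ht : 0 ≤ t) : (t : ℂ) + b ∈ Complex.slitPlane := by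
  left
  simp
  linarith

lemma cx_norm {b : ℂ} (hb : 1/4 < b.re) {t : ℝ} (ht : 0 ≤ t) : (1 + t) / 4 ≤ ‖(t : ℂ) + b‖ := by
  refine le_trans ?_ (Complex.re_le_norm _)
  simp
  linarith

lemma cx_bound {a b : ℂ} (ha : 1/4 < a.re) (hb : 1/4 < b.re) {t : ℝ} (ht : 0 ≤ t) :
    ‖(Real.log t : ℂ) / (((t : ℂ) + a) * (t + b))‖ ≤ 16 * (|Real.log t| / (1 + t) ^ 2) := by
  have h1 := cx_norm ha ht
  have h2 := cx_norm hb ht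
  rw [norm_div, norm_mul, Complex.norm_real, Real.norm_eq_abs]
  calc _ ≤ |Real.log t| / ((1 + t) / 4 * ((1 + t) / 4)) := by gcongr
    _ = _ := by field_simp; ring

lemma cx_int {a b : ℂ} (ha : 1/4 < a.re) (hb : 1/4 < b.re) :
    IntegrableOn (fun t : ℝ => (Real.log t : ℂ) / (((t : ℂ) + a) * (t + b))) (Ioi 0) := by
  refine Integrable.mono' (aux_int_w.const_mul 16) ?_ ?_
  · refine Measurable.aestronglyMeasurable ?_
    refine Measurable.div ?_ (by fun_prop)
    exact Complex.measurable_ofReal.comp measurable_log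
  · refine (ae_restrict_iff' measurableSet_Ioi).2 (Eventually.of_forall fun t ht => ?_)
    exact cx_bound ha hb (le_of_lt ht)

lemma cx_log_div {b : ℂ} (hb : 1/4 < b.re) :
    Tendsto (fun t : ℝ => (Real.log t : ℂ) / ((t : ℂ) + b)) atTop (𝓝 0) := by
  refine squeeze_zero_norm' (a := fun t => 4 * (Real.log t / t)) ?_ (by simpa using aux_log_div.const_mul 4)
  filter_upwards [eventually_gt_atTop 1] with t ht
  have h1 := cx_norm hb (by linarith : (0:ℝ) ≤ t)
  have h2 := Real.log_nonneg ht.le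
  rw [norm_div, Complex.norm_real, Real.norm_eq_abs, abs_of_nonneg h2]
  calc Real.log t / ‖(t : ℂ) + b‖ ≤ Real.log t / (t / 4) := by
        gcongr
        linarith
    _ = _ := by field_simp

lemma cx_sq {b : ℂ} (hb : 1/4 < b.re) :
    ∫ t in Ioi (0:ℝ), (Real.log t : ℂ) / (((t : ℂ) + b) * (t + b)) = Complex.log b / b := by
  have hb0 : b ≠ 0 := by simpa using cx_ne hb le_rfl
  have h := integral_Ioi_of_hasDerivAt_of_tendsto (a := 0) (m := 0)
    (f := fun t : ℝ => (((t * Real.log t : ℝ) : ℂ) / (t + b) - Complex.log (t + b)) / b)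
    (f' := fun t : ℝ => (Real.log t : ℂ) / (((t : ℂ) + b) * (t + b))) ?_ ?_ (cx_int hb hb) ?_
  · rw [h]; simp; ring
  · have h1 : ContinuousAt (fun t : ℝ => (t : ℂ) + b) 0 := by fun_prop
    refine ContinuousAt.continuousWithinAt ?_
    refine ContinuousAt.div_const (ContinuousAt.sub (ContinuousAt.div ?_ h1 (cx_ne hb le_rfl)) ?_) _
    · exact (Complex.continuous_ofReal.comp Real.continuous_mul_log).continuousAt
    · exact h1.clog (cx_slit hb le_rfl)
  · intro t ht
    have ht : 0 < t := ht
    have h0 := cx_ne hb ht.le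
    have h1 : HasDerivAt (fun t : ℝ => (t : ℂ) + b) 1 t := (Complex.ofRealCLM.hasDerivAt (x := t)).add_const b
    have h2 : HasDerivAt (fun t : ℝ => ((t * Real.log t : ℝ) : ℂ)) ((Real.log t + 1 : ℝ) : ℂ) t :=
      (Real.hasDerivAt_mul_log ht.ne').ofReal_comp
    refine (((h2.fun_div h1 h0).fun_sub (h1.clog_real (cx_slit hb ht.le))).div_const b).congr_deriv ?_
    push_cast
    field_simp
    ring
  · have hlim : Tendsto (fun t : ℝ => (-(b * ((Real.log t : ℂ) / ((t : ℂ) + b))) - Complex.log (1 + b * ((t⁻¹ : ℝ) : ℂ))) / b)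
        atTop (𝓝 ((-(b * 0) - Complex.log (1 + b * ((0:ℝ) : ℂ))) / b)) := by
      refine Tendsto.div_const (Tendsto.sub ((cx_log_div hb).const_mul b).neg ?_) b
      refine Tendsto.clog ?_ (by simp)
      exact (((Complex.continuous_ofReal.tendsto 0).comp tendsto_inv_atTop_zero).const_mul b).const_add 1
    have e : (-(b * 0) - Complex.log (1 + b * ((0:ℝ) : ℂ))) / b = 0 := by simp
    rw [e] at hlim
    refine hlim.congr' ?_
    filter_upwards [eventually_gt_atTop 0] with t ht
    have h0 := cx_ne hb ht.le
    have htc : (t : ℂ) ≠ 0 := by exact_mod_cast ht.ne'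
    have h1 : (t : ℂ) + b = t * (1 + b * ((t⁻¹ : ℝ) : ℂ)) := by
      push_cast; field_simp
    have h2 : (1 + b * ((t⁻¹ : ℝ) : ℂ)) ≠ 0 := by
      intro h; rw [h, mul_zero] at h1; exact h0 h1
    have h3 : Complex.log ((t : ℂ) + b) = Real.log t + Complex.log (1 + b * ((t⁻¹ : ℝ) : ℂ)) := by
      rw [h1, Complex.log_ofReal_mul ht h2]
    rw [h3]
    push_cast
    field_simp
    ring

lemma LL_zero : LL 0 0 = 0 := by
  have h := cx_sq (b := 1) (by norm_num)
  have h2 : (LL 0 0 : ℂ) = 0 := by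
    rw [LL, ← integral_complex_ofReal]
    rw [Complex.log_one, zero_div] at h
    rw [← h]
    congr 1; ext t
    simp [wt]
    ring
  exact_mod_cast h2

/-- the difference integral -/
noncomputable def GG (b : ℂ) : ℂ :=
  ∫ t in Ioi (0:ℝ), (Real.log t : ℂ) * (1 / ((t : ℂ) + 1/2) - 1 / (t + b))

lemma half_re : (1/4 : ℝ) < (1/2 : ℂ).re := by norm_num

lemma GG_int {b : ℂ} (hb : 1/4 < b.re) :
    IntegrableOn (fun t : ℝ => (Real.log t : ℂ) * (1 / ((t : ℂ) + 1/2) - 1 / (t + b))) (Ioi 0) := by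
  refine IntegrableOn.congr_fun ((cx_int half_re hb).const_mul (b - 1/2)) ?_ measurableSet_Ioi
  intro t ht
  have h1 := cx_ne half_re (le_of_lt ht)
  have h2 := cx_ne hb (le_of_lt ht)
  simp only
  rw [div_sub_div _ _ h1 h2]
  ring

lemma GG_deriv {b : ℂ} (hb : 1/4 < b.re) : HasDerivAt GG (Complex.log b / b) b := by
  have hopen : IsOpen {z : ℂ | 1/4 < z.re} := isOpen_lt continuous_const Complex.continuous_re
  have h := hasDerivAt_integral_of_dominated_loc_of_deriv_le (μ := volume.restrict (Ioi (0:ℝ)))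
    (F := fun (b : ℂ) (t : ℝ) => (Real.log t : ℂ) * (1 / ((t : ℂ) + 1/2) - 1 / (t + b)))
    (F' := fun (b : ℂ) (t : ℝ) => (Real.log t : ℂ) / (((t : ℂ) + b) * (t + b)))
    (x₀ := b) (bound := fun t => 16 * (|Real.log t| / (1 + t) ^ 2))
    (hopen.mem_nhds hb) ?_ (GG_int hb) (cx_int hb hb).aestronglyMeasurable ?_ (aux_int_w.const_mul 16) ?_
  · have h2 := h.2
    rw [cx_sq hb] at h2
    exact h2
  · filter_upwards [hopen.mem_nhds hb] with z hz
    exact (GG_int hz).aestronglyMeasurable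
  · refine (ae_restrict_iff' measurableSet_Ioi).2 (Eventually.of_forall fun t ht z hz => ?_)
    exact cx_bound hz hz (le_of_lt ht)
  · refine (ae_restrict_iff' measurableSet_Ioi).2 (Eventually.of_forall fun t ht z hz => ?_)
    have h0 := cx_ne hz (le_of_lt ht)
    have h1 : HasDerivAt (fun z : ℂ => (t : ℂ) + z) 1 z := (hasDerivAt_id' z).const_add _
    refine (((((hasDerivAt_const z (1:ℂ)).fun_div h1 h0)).const_sub (1 / ((t : ℂ) + 1/2))).const_mul (Real.log t : ℂ)).congr_deriv ?_
    field_simp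
    ring

lemma GG_eq {b : ℂ} (hb : 1/4 < b.re) :
    GG b = (Complex.log b ^ 2 - Complex.log (1/2) ^ 2) / 2 := by
  have hopen : IsOpen {z : ℂ | 1/4 < z.re} := isOpen_lt continuous_const Complex.continuous_re
  have hconv : Convex ℝ {z : ℂ | 1/4 < z.re} := convex_halfSpace_re_gt _
  have hd : ∀ z : ℂ, 1/4 < z.re → HasDerivAt (fun z => (Complex.log z ^ 2 - Complex.log (1/2) ^ 2) / 2)
      (Complex.log z / z) z := fun z hz => by
    have hs : z ∈ Complex.slitPlane := by simpa using cx_slit hz le_rfl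
    refine ((((Complex.hasDerivAt_log hs).fun_pow 2).sub_const _).div_const 2).congr_deriv ?_
    simp
    ring
  refine hopen.eqOn_of_deriv_eq hconv.isPreconnected
    (fun z hz => (GG_deriv hz).differentiableAt.differentiableWithinAt)
    (fun z hz => (hd z hz).differentiableAt.differentiableWithinAt)
    (fun z hz => by rw [(GG_deriv hz).deriv, (hd z hz).deriv]) half_re ?_ hb
  simp [GG]

lemma log_one_I : Complex.log (1 + Complex.I) = (Real.log 2 / 2 : ℝ) + (π / 4 : ℝ) * Complex.I := by
  have h : (1 + Complex.I) = Complex.exp ((Real.log 2 / 2 : ℝ) + (π / 4 : ℝ) * Complex.I) := by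
    rw [Complex.exp_add, Complex.exp_mul_I, ← Complex.ofReal_exp, ← Complex.ofReal_cos, ← Complex.ofReal_sin,
      Real.cos_pi_div_four, Real.sin_pi_div_four]
    have h2 : Real.exp (Real.log 2 / 2) = √2 := by
      rw [Real.sqrt_eq_rpow, Real.rpow_def_of_pos two_pos]; congr 1; ring
    rw [h2]
    have h3 : ((√2 : ℝ) : ℂ) * ((√2 : ℝ) : ℂ) = 2 := by
      rw [← Complex.ofReal_mul, Real.mul_self_sqrt (by norm_num)]; norm_num
    push_cast
    linear_combination (-(1 + Complex.I) / 2) * h3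
  rw [h, Complex.log_exp]
  · rw [Complex.add_im, Complex.ofReal_im, Complex.im_ofReal_mul, Complex.I_im]; linarith [Real.pi_pos]
  · rw [Complex.add_im, Complex.ofReal_im, Complex.im_ofReal_mul, Complex.I_im]; linarith [Real.pi_pos]

lemma log_half : Complex.log (1/2) = ((-Real.log 2 : ℝ) : ℂ) := by
  rw [← Real.log_inv, Complex.ofReal_log (by norm_num)]
  congr 1; norm_num

/-- the rational function -/
noncomputable def RR (t : ℝ) : ℝ := t ^ 2 * (1 + t) / ((1 + 2 * t) ^ 2 * (t ^ 2 + 2 * t + 2) ^ 2)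

lemma main_int : ∫ t in Ioi (0:ℝ), Real.log t * RR t = -π / 200 + 9 * π ^ 2 / 4000 + (3 / 100) * Real.log 2 +
        (27 / 1000) * (Real.log 2) ^ 2 - (13 / 1000) * π * Real.log 2 := by
  have hβ : (1/4 : ℝ) < (1 + Complex.I).re := by simp; norm_num
  have i1 := (cx_int half_re half_re).const_mul (1/50 : ℂ)
  have i2 := (cx_int hβ hβ).const_mul ((3 + 4 * Complex.I)/25 : ℂ)
  have i3 := (GG_int hβ).const_mul ((9 - 13 * Complex.I)/125 : ℂ)
  have hsum := (i1.add i2).sub i3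
  have hval : ∫ t in Ioi (0:ℝ), ((1/50 : ℂ) * ((Real.log t : ℂ) / (((t : ℂ) + 1/2) * (t + 1/2)))
      + (3 + 4 * Complex.I)/25 * ((Real.log t : ℂ) / (((t : ℂ) + (1 + Complex.I)) * (t + (1 + Complex.I))))
      - (9 - 13 * Complex.I)/125 * ((Real.log t : ℂ) * (1 / ((t : ℂ) + 1/2) - 1 / (t + (1 + Complex.I)))))
      = (1/50 : ℂ) * (Complex.log (1/2) / (1/2)) + (3 + 4 * Complex.I)/25 * (Complex.log (1 + Complex.I) / (1 + Complex.I))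
        - (9 - 13 * Complex.I)/125 * ((Complex.log (1 + Complex.I) ^ 2 - Complex.log (1/2) ^ 2) / 2) := by
    rw [← cx_sq half_re, ← cx_sq hβ, ← GG_eq hβ, GG, ← integral_const_mul, ← integral_const_mul,
      ← integral_const_mul]
    rw [← integral_add i1 i2]
    exact integral_sub (i1.add i2) i3
  have hre := integral_re hsum
  have hre2 : ∫ t in Ioi (0:ℝ), Real.log t * RR t = ∫ t in Ioi (0:ℝ), ((1/50 : ℂ) * ((Real.log t : ℂ) / (((t : ℂ) + 1/2) * (t + 1/2)))
      + (3 + 4 * Complex.I)/25 * ((Real.log t : ℂ) / (((t : ℂ) + (1 + Complex.I)) * (t + (1 + Complex.I))))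
      - (9 - 13 * Complex.I)/125 * ((Real.log t : ℂ) * (1 / ((t : ℂ) + 1/2) - 1 / (t + (1 + Complex.I))))).re := by
    refine setIntegral_congr_fun measurableSet_Ioi fun t ht => ?_
    have ht : 0 < t := ht
    have hq : (1 + t)^2 + 1 ≠ 0 := by positivity
    have e1 : 1 / ((t : ℂ) + 1/2) = ((1 / (t + 1/2) : ℝ) : ℂ) := by push_cast; rfl
    have e2 : 1 / ((t : ℂ) + (1 + Complex.I)) = (((1 + t) / ((1 + t)^2 + 1) : ℝ) : ℂ) - ((1 / ((1+t)^2+1) : ℝ) : ℂ) * Complex.I := by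
      have hqc : ((1 + t : ℂ)^2 + 1) ≠ 0 := by exact_mod_cast hq
      rw [div_eq_iff (cx_ne hβ ht.le)]
      push_cast
      field_simp
      linear_combination Complex.I_sq
    have e3 : ∀ z : ℂ, (Real.log t : ℂ) / (z * z) = Real.log t * (1 / z) * (1 / z) := fun z => by
      rw [div_mul_eq_div_mul_one_div]; ring
    have e4 : ∀ x y : ℝ, ((3 + 4 * Complex.I)/25 : ℂ) = ((3/25 : ℝ) : ℂ) + ((4/25 : ℝ) : ℂ) * Complex.I := fun _ _ => by
      push_cast; ring
    have e5 : ((9 - 13 * Complex.I)/125 : ℂ) = ((9/125 : ℝ) : ℂ) - ((13/125 : ℝ) : ℂ) * Complex.I := by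
      push_cast; ring
    have e6 : (1/50 : ℂ) = ((1/50 : ℝ) : ℂ) := by push_cast; rfl
    rw [e3, e3, e1, e2, e4 0 0, e5, e6]
    simp only [Complex.add_re, Complex.sub_re, Complex.mul_re, Complex.add_im, Complex.sub_im, Complex.mul_im,
      Complex.ofReal_re, Complex.ofReal_im, Complex.I_re, Complex.I_im]
    have hq2 : t^2 + 2 * t + 2 = (1 + t)^2 + 1 := by ring
    have hh : 1 + 2 * t ≠ 0 := by positivity
    have hh2 : t + 1 / 2 ≠ 0 := by positivity
    unfold RR
    rw [hq2]
    field_simp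
    ring
  rw [hre2]
  have hre3 := hre.trans (congrArg Complex.re hval)
  refine hre3.trans ?_
  have e7 : 1 / (1 + Complex.I) = ((1/2 : ℝ) : ℂ) - ((1/2 : ℝ) : ℂ) * Complex.I := by
    rw [div_eq_iff (by simpa using cx_ne hβ le_rfl)]
    push_cast
    linear_combination (1/2) * Complex.I_sq
  have e4 : ((3 + 4 * Complex.I)/25 : ℂ) = ((3/25 : ℝ) : ℂ) + ((4/25 : ℝ) : ℂ) * Complex.I := by
      push_cast; ring
  have e5 : ((9 - 13 * Complex.I)/125 : ℂ) = ((9/125 : ℝ) : ℂ) - ((13/125 : ℝ) : ℂ) * Complex.I := by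
      push_cast; ring
  have e6 : ∀ z : ℂ, (1/50 : ℂ) * (z / (1/2)) = ((1/25 : ℝ) : ℂ) * z := fun z => by push_cast; ring
  have e8 : ∀ z w : ℂ, (z ^ 2 - w ^ 2) / 2 = ((1/2 : ℝ) : ℂ) * (z * z - w * w) := fun z w => by push_cast; ring
  rw [e6, e4, e5, e8, div_eq_mul_one_div (Complex.log (1 + Complex.I)), e7, log_one_I, log_half]
  simp only [Complex.add_re, Complex.sub_re, Complex.mul_re, Complex.add_im, Complex.sub_im, Complex.mul_im,
      Complex.ofReal_re, Complex.ofReal_im, Complex.I_re, Complex.I_im]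
  ring

theorem stmt_18 :
    ∑' k : ℕ, ((harmonic (2 * k) : ℝ) - (harmonic k : ℝ)) * k /
        ((3 * k + 1) * (Nat.choose (3 * k) k : ℝ) * 2 ^ (k + 1)) =
      -π / 200 + 9 * π ^ 2 / 4000 + (3 / 100) * Real.log 2 +
        (27 / 1000) * (Real.log 2) ^ 2 - (13 / 1000) * π * Real.log 2 := by
  rw [← main_int]
  have hterm : ∀ k : ℕ, ((harmonic (2 * k) : ℝ) - (harmonic k : ℝ)) * k /
        ((3 * k + 1) * (Nat.choose (3 * k) k : ℝ) * 2 ^ (k + 1)) =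
      ∫ t in Ioi (0:ℝ), (k / 2 ^ (k+1) : ℝ) * (wt (2*k) k t * Real.log t / (1+t)^2) := by
    intro k
    have hL := LL_eq LL_zero (2*k) k
    rw [integral_const_mul]
    rw [LL, BB_eq] at hL
    rw [hL]
    have hc : (Nat.choose (3*k) k : ℝ) * ((k.factorial : ℝ) * ((2*k).factorial : ℝ)) = ((3*k).factorial : ℝ) := by
      have := Nat.choose_mul_factorial_mul_factorial (show k ≤ 3*k by omega)
      rw [show 3*k - k = 2*k by omega, mul_assoc] at this
      exact_mod_cast this
    have hf : ((2*k+k+1).factorial : ℝ) = (3*k+1) * ((3*k).factorial : ℝ) := by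
      rw [show 2*k+k+1 = 3*k+1 by ring, Nat.factorial_succ]; push_cast; ring
    rw [hf, ← hc]
    have h1 := Nat.factorial_ne_zero k
    have h2 := Nat.factorial_ne_zero (2*k)
    have h3 : (Nat.choose (3*k) k) ≠ 0 := (Nat.choose_pos (by omega)).ne'
    field_simp
  simp_rw [hterm]
  have hgeo : HasSum (fun k : ℕ => (k : ℝ) * (1/2) ^ k) ((1/2) / (1 - 1/2)^2) :=
    hasSum_coe_mul_geometric_of_norm_lt_one (by norm_num)
  have hsm : Summable (fun k : ℕ => (k / 2 ^ (k+1) : ℝ)) := by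
    refine (hgeo.summable.mul_right (1/2)).congr fun k => ?_
    rw [one_div, inv_pow, pow_succ]; field_simp
  refine HasSum.tsum_eq (hasSum_integral_of_dominated_convergence
    (fun (k : ℕ) t => (k / 2 ^ (k+1) : ℝ) * (|Real.log t| / (1+t)^2)) ?_ ?_ ?_ ?_ ?_)
  · intro k
    exact ((wtl_meas _ _).const_mul _).aestronglyMeasurable
  · intro k
    refine (ae_restrict_iff' measurableSet_Ioi).2 (Eventually.of_forall fun t ht => ?_)
    rw [norm_mul, Real.norm_eq_abs, abs_of_nonneg (by positivity)]
    exact mul_le_mul_of_nonneg_left (wtl_le _ _ ht) (by positivity)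
  · exact Eventually.of_forall fun t => hsm.mul_right _
  · simp_rw [tsum_mul_right]
    exact aux_int_w.const_mul _
  · refine (ae_restrict_iff' measurableSet_Ioi).2 (Eventually.of_forall fun t ht => ?_)
    have ht : 0 < t := ht
    have h1 := wt_nonneg 2 1 ht
    have h2 := wt_le 2 1 ht
    have hz : ‖wt 2 1 t / 2‖ < 1 := by
      rw [Real.norm_eq_abs, abs_of_nonneg (by positivity)]; linarith
    have hs := (hasSum_coe_mul_geometric_of_norm_lt_one hz).mul_right (Real.log t / (1+t)^2 / 2)
    have E1 : (fun k : ℕ => (k / 2 ^ (k+1) : ℝ) * (wt (2*k) k t * Real.log t / (1+t)^2)) =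
        fun k : ℕ => (k : ℝ) * (wt 2 1 t / 2) ^ k * (Real.log t / (1+t)^2 / 2) := by
      ext k
      have : wt (2*k) k t = wt 2 1 t ^ k := by
        unfold wt; rw [mul_pow, pow_mul, pow_one]
      rw [this, div_pow, pow_succ]
      field_simp
    have E2 : Real.log t * RR t = wt 2 1 t / 2 / (1 - wt 2 1 t / 2) ^ 2 * (Real.log t / (1 + t) ^ 2 / 2) := by
      have hw : wt 2 1 t = t^2 / (1+t)^3 := by
        unfold wt; field_simp
      have hd : 1 - wt 2 1 t / 2 = (1 + 2*t) * (t^2+2*t+2) / (2 * (1+t)^3) := by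
        rw [hw]; field_simp; ring
      rw [hd, hw]
      unfold RR
      field_simp
    rw [E1, E2]
    exact hs
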